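/- Deterministic prediction oracle inequality for the sg-LASSO (deterministic core of Theorem 1). Let y = m + u with m, u ∈ ℝ^T, let λ > 0, c > 1, set c₀ = (c+1)/(c−1), let β ∈ ℝ^p with β ≠ 0, support S₀ and group support 𝒢₀, and let β̂ ∈ ℝ^p be any minimizer over b ∈ ℝ^p of ‖y − Xb‖_T² + 2λΩ(b). Assume: (i) the dual-norm bound |⟨u, Xb⟩|/T ≤ (λ/c) Ω(b) for all b ∈ ℝ^p; (ii) the restricted eigenvalue condition: Σ is a symmetric p×p real matrix and γ > 0 satisfies Δᵀ Σ Δ ≥ γ ∑_{G∈𝒢₀} |Δ_G|₂² for every Δ ∈ 𝒞(c₀); (iii) every entry of Xᵀ X / T − Σ has absolute value at most γ / (2 G* s_α (1 + 2c₀)²). Then ‖X(β̂ − β)‖_T² ≤ C₁ s_α λ² + 4 ‖m − Xβ‖_T², where C₁ = 4A(1+c₀)²(1 + 1/c)²/γ and A = 2(1+2c₀)² / (2(1+2c₀)² − (1+c₀)²). -/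

import Mathlib

open Finset

noncomputable section

open scoped Classical

/-- ℓ1 norm on ℝ^p. -/
def l1 {p : ℕ} (b : Fin p → ℝ) : ℝ := ∑ i, |b i|

/-- ℓ2 norm on ℝ^p. -/
def l2 {p : ℕ} (b : Fin p → ℝ) : ℝ := Real.sqrt (∑ i, (b i) ^ 2)

/-- `restr b S` keeps the coordinates of `b` on `S` and puts zeros elsewhere. -/
def restr {p : ℕ} (b : Fin p → ℝ) (S : Finset (Fin p)) : Fin p → ℝ :=
  fun i => if i ∈ S then b i else 0

/-- `G` is a partition of `{1,…,p}` into nonempty pairwise disjoint groups. -/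
def IsPartition {p : ℕ} (G : Finset (Finset (Fin p))) : Prop :=
  (∀ g ∈ G, g.Nonempty) ∧ (∀ g ∈ G, ∀ g' ∈ G, g ≠ g' → Disjoint g g') ∧
    (∀ i : Fin p, ∃ g ∈ G, i ∈ g)

/-- The sg-LASSO penalty `Ω(b) = α|b|₁ + (1−α)∑_{G∈𝒢}|b_G|₂`. -/
def sgl {p : ℕ} (α : ℝ) (G : Finset (Finset (Fin p))) (b : Fin p → ℝ) : ℝ :=
  α * l1 b + (1 - α) * ∑ g ∈ G, l2 (restr b g)

/-- Support `S₀ = {j : β_j ≠ 0}` of `β`. -/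
def supp {p : ℕ} (β : Fin p → ℝ) : Finset (Fin p) :=
  Finset.univ.filter (fun j => β j ≠ 0)

/-- Group support `𝒢₀ = {G ∈ 𝒢 : β_G ≠ 0}` of `β`. -/
def gsupp {p : ℕ} (G : Finset (Finset (Fin p))) (β : Fin p → ℝ) :
    Finset (Finset (Fin p)) :=
  G.filter (fun g => restr β g ≠ 0)

/-- `Ω₀(b) = α|b_{S₀}|₁ + (1−α)∑_{G∈𝒢₀}|b_G|₂`. -/
def sgl0 {p : ℕ} (α : ℝ) (G : Finset (Finset (Fin p))) (β b : Fin p → ℝ) : ℝ :=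
  α * l1 (restr b (supp β)) + (1 - α) * ∑ g ∈ gsupp G β, l2 (restr b g)

/-- `Ω₁(b) = α|b_{S₀ᶜ}|₁ + (1−α)∑_{G∈𝒢∖𝒢₀}|b_G|₂`. -/
def sgl1 {p : ℕ} (α : ℝ) (G : Finset (Finset (Fin p))) (β b : Fin p → ℝ) : ℝ :=
  α * l1 (restr b (supp β)ᶜ) + (1 - α) * ∑ g ∈ G \ gsupp G β, l2 (restr b g)

/-- Effective sparsity constant `s_α`, defined via
`√(s_α) = α√|S₀| + (1−α)√|𝒢₀|`. -/
def salpha {p : ℕ} (α : ℝ) (G : Finset (Finset (Fin p))) (β : Fin p → ℝ) : ℝ :=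
  (α * Real.sqrt ((supp β).card) + (1 - α) * Real.sqrt ((gsupp G β).card)) ^ 2

/-- Empirical squared norm `‖v‖_T² = |v|₂²/T`. -/
def normT2 {T : ℕ} (v : Fin T → ℝ) : ℝ := (∑ t, (v t) ^ 2) / T

/-- Empirical norm `‖v‖_T = √(|v|₂²/T)`. -/
def normT {T : ℕ} (v : Fin T → ℝ) : ℝ := Real.sqrt ((∑ t, (v t) ^ 2) / T)

lemma l2_eq {p : ℕ} (b : Fin p → ℝ) : l2 b = ‖(WithLp.toLp 2 b : EuclideanSpace ℝ (Fin p))‖ := by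
  simp [l2, EuclideanSpace.norm_eq]

lemma l2_nonneg {p : ℕ} (b : Fin p → ℝ) : 0 ≤ l2 b := Real.sqrt_nonneg _

lemma l2_add {p : ℕ} (a b : Fin p → ℝ) : l2 (a + b) ≤ l2 a + l2 b := by
  simp only [l2_eq, WithLp.toLp_add]
  exact norm_add_le _ _

lemma l2_smul {p : ℕ} (t : ℝ) (ht : 0 ≤ t) (b : Fin p → ℝ) : l2 (t • b) = t * l2 b := by
  simp only [l2_eq, WithLp.toLp_smul, norm_smul, Real.norm_eq_abs, abs_of_nonneg ht]

lemma l2_neg {p : ℕ} (b : Fin p → ℝ) : l2 (-b) = l2 b := by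
  simp [l2]

lemma l2_sq {p : ℕ} (b : Fin p → ℝ) : l2 b ^ 2 = ∑ i, b i ^ 2 :=
  Real.sq_sqrt (Finset.sum_nonneg fun i _ => sq_nonneg _)

lemma restr_add {p : ℕ} (a b : Fin p → ℝ) (S : Finset (Fin p)) :
    restr (a + b) S = restr a S + restr b S := by
  ext i; by_cases h : i ∈ S <;> simp [restr, h]

lemma restr_smul {p : ℕ} (t : ℝ) (b : Fin p → ℝ) (S : Finset (Fin p)) :
    restr (t • b) S = t • restr b S := by
  ext i; by_cases h : i ∈ S <;> simp [restr, h]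

lemma l2_restr_sq {p : ℕ} (b : Fin p → ℝ) (S : Finset (Fin p)) :
    l2 (restr b S) ^ 2 = ∑ i ∈ S, b i ^ 2 := by
  have : ∀ i, restr b S i ^ 2 = if i ∈ S then b i ^ 2 else 0 := by
    intro i; by_cases h : i ∈ S <;> simp [restr, h]
  rw [l2_sq]
  simp [this]

lemma l1_restr {p : ℕ} (b : Fin p → ℝ) (S : Finset (Fin p)) :
    l1 (restr b S) = ∑ i ∈ S, |b i| := by
  have : ∀ i, |restr b S i| = if i ∈ S then |b i| else 0 := by
    intro i; by_cases h : i ∈ S <;> simp [restr, h]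
  simp [l1, this]

lemma sgl_convex {p : ℕ} (α : ℝ) (hα0 : 0 ≤ α) (hα1 : α ≤ 1) (G : Finset (Finset (Fin p)))
    (a b : Fin p → ℝ) (s t : ℝ) (hs : 0 ≤ s) (ht : 0 ≤ t) :
    sgl α G (s • a + t • b) ≤ s * sgl α G a + t * sgl α G b := by
  have h1 : l1 (s • a + t • b) ≤ s * l1 a + t * l1 b := by
    simp only [l1, Finset.mul_sum, ← Finset.sum_add_distrib]
    refine Finset.sum_le_sum fun i _ => ?_
    calc |(s • a + t • b) i| ≤ |s * a i| + |t * b i| := abs_add_le _ _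
      _ = _ := by rw [abs_mul, abs_mul, abs_of_nonneg hs, abs_of_nonneg ht]
  have h2 : ∑ g ∈ G, l2 (restr (s • a + t • b) g) ≤
      s * ∑ g ∈ G, l2 (restr a g) + t * ∑ g ∈ G, l2 (restr b g) := by
    simp only [Finset.mul_sum, ← Finset.sum_add_distrib]
    refine Finset.sum_le_sum fun g _ => ?_
    rw [restr_add, restr_smul, restr_smul, ← l2_smul s hs, ← l2_smul t ht]
    exact l2_add _ _
  have h3 := mul_le_mul_of_nonneg_left h1 hα0
  have h4 := mul_le_mul_of_nonneg_left h2 (sub_nonneg.2 hα1)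
  unfold sgl
  linarith

lemma sgl_split {p : ℕ} (α : ℝ) (G : Finset (Finset (Fin p))) (β Δ : Fin p → ℝ) :
    sgl α G Δ = sgl0 α G β Δ + sgl1 α G β Δ := by
  have h1 : l1 Δ = l1 (restr Δ (supp β)) + l1 (restr Δ (supp β)ᶜ) := by
    rw [l1_restr, l1_restr, Finset.sum_add_sum_compl]; rfl
  have h2 := Finset.sum_sdiff (f := fun g => l2 (restr Δ g))
    (Finset.filter_subset (fun g => restr β g ≠ 0) G)
  unfold sgl sgl0 sgl1 gsupp
  rw [h1, ← h2]; ring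

lemma sgl_decomp {p : ℕ} (α : ℝ) (hα0 : 0 ≤ α) (hα1 : α ≤ 1) (G : Finset (Finset (Fin p)))
    (β Δ : Fin p → ℝ) :
    sgl α G β - sgl α G (β + Δ) ≤ sgl0 α G β Δ - sgl1 α G β Δ := by
  have h1 : l1 β - l1 (β + Δ) ≤ l1 (restr Δ (supp β)) - l1 (restr Δ (supp β)ᶜ) := by
    simp only [l1, ← Finset.sum_sub_distrib]
    refine Finset.sum_le_sum fun i _ => ?_
    by_cases h : β i = 0
    · simp [restr, supp, h]
    · have := abs_sub_abs_le_abs_sub (β i) (β i + Δ i)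
      simp [restr, supp, h] at this ⊢
      linarith
  have h2 : ∑ g ∈ G, (l2 (restr β g) - l2 (restr (β + Δ) g)) ≤
      ∑ g ∈ gsupp G β, l2 (restr Δ g) - ∑ g ∈ G \ gsupp G β, l2 (restr Δ g) := by
    rw [← Finset.sum_sdiff (Finset.filter_subset (fun g => restr β g ≠ 0) G)]
    have e1 : ∑ g ∈ G \ gsupp G β, (l2 (restr β g) - l2 (restr (β + Δ) g)) ≤
        ∑ g ∈ G \ gsupp G β, - l2 (restr Δ g) := by
      refine Finset.sum_le_sum fun g hg => ?_
      have : restr β g = 0 := by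
        simp only [gsupp, Finset.mem_sdiff, Finset.mem_filter, not_and, not_not] at hg
        exact hg.2 hg.1
      rw [restr_add, this]
      simp [l2]
    have e2 : ∑ g ∈ gsupp G β, (l2 (restr β g) - l2 (restr (β + Δ) g)) ≤
        ∑ g ∈ gsupp G β, l2 (restr Δ g) := by
      refine Finset.sum_le_sum fun g hg => ?_
      have := l2_add (restr (β + Δ) g) (-restr Δ g)
      rw [l2_neg, restr_add, add_neg_cancel_right] at this
      rw [restr_add]
      linarith
    rw [Finset.sum_neg_distrib] at e1
    unfold gsupp at e1 e2 ⊢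
    linarith
  rw [Finset.sum_sub_distrib] at h2
  have h3 := mul_le_mul_of_nonneg_left h1 hα0
  have h4 := mul_le_mul_of_nonneg_left h2 (sub_nonneg.2 hα1)
  unfold sgl sgl0 sgl1
  linarith

lemma sum_abs_le {ι : Type*} (S : Finset ι) (f : ι → ℝ) :
    ∑ i ∈ S, |f i| ≤ Real.sqrt S.card * Real.sqrt (∑ i ∈ S, f i ^ 2) := by
  rw [← Real.sqrt_mul (Nat.cast_nonneg _)]
  apply Real.le_sqrt_of_sq_le
  have := sq_sum_le_card_mul_sum_sq (s := S) (f := fun i => |f i|)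
  simpa using this

lemma part_sum {p : ℕ} {G : Finset (Finset (Fin p))} (hG : IsPartition G) (f : Fin p → ℝ) :
    ∑ i, f i = ∑ g ∈ G, ∑ i ∈ g, f i := by
  have : (univ : Finset (Fin p)) = G.biUnion id := by
    ext i; simpa using hG.2.2 i
  rw [this, Finset.sum_biUnion]
  · rfl
  · intro a ha b hb hab
    exact hG.2.1 a ha b hb hab

lemma l1_le {p : ℕ} (α : ℝ) (hα0 : 0 ≤ α) (hα1 : α ≤ 1) {G : Finset (Finset (Fin p))}
    (hG : IsPartition G) (b : Fin p → ℝ) (n : ℕ) (hn : n = G.sup Finset.card) (hn1 : 1 ≤ n) :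
    l1 b ≤ Real.sqrt n * sgl α G b := by
  have h1 : l1 b ≤ Real.sqrt n * l1 b := by
    have : (1 : ℝ) ≤ Real.sqrt n := by
      rw [Real.one_le_sqrt]; exact_mod_cast hn1
    have h0 : 0 ≤ l1 b := Finset.sum_nonneg fun i _ => abs_nonneg _
    nlinarith
  have h2 : l1 b ≤ Real.sqrt n * ∑ g ∈ G, l2 (restr b g) := by
    unfold l1
    rw [part_sum hG, Finset.mul_sum]
    refine Finset.sum_le_sum fun g hg => ?_
    refine (sum_abs_le g b).trans ?_
    rw [← l2_restr_sq, Real.sqrt_sq (l2_nonneg _)]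
    refine mul_le_mul_of_nonneg_right (Real.sqrt_le_sqrt ?_) (l2_nonneg _)
    rw [hn]
    exact_mod_cast Finset.le_sup (f := Finset.card) hg
  have h3 := mul_le_mul_of_nonneg_left h1 hα0
  have h4 := mul_le_mul_of_nonneg_left h2 (sub_nonneg.2 hα1)
  unfold sgl
  linarith

lemma sgl0_le {p : ℕ} (α : ℝ) (hα0 : 0 ≤ α) (hα1 : α ≤ 1) {G : Finset (Finset (Fin p))}
    (hG : IsPartition G) (β b : Fin p → ℝ) :
    sgl0 α G β b ≤ (α * Real.sqrt ((supp β).card) + (1 - α) * Real.sqrt ((gsupp G β).card)) *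
      Real.sqrt (∑ g ∈ gsupp G β, l2 (restr b g) ^ 2) := by
  have h1 : l1 (restr b (supp β)) ≤ Real.sqrt ((supp β).card) *
      Real.sqrt (∑ g ∈ gsupp G β, l2 (restr b g) ^ 2) := by
    rw [l1_restr]
    refine (sum_abs_le _ _).trans ?_
    refine mul_le_mul_of_nonneg_left (Real.sqrt_le_sqrt ?_) (Real.sqrt_nonneg _)
    simp only [l2_restr_sq]
    rw [← Finset.sum_biUnion (t := fun g => g)]
    · refine Finset.sum_le_sum_of_subset_of_nonneg ?_ (fun _ _ _ => sq_nonneg _)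
      intro i hi
      obtain ⟨g, hg, hig⟩ := hG.2.2 i
      simp only [Finset.mem_biUnion, gsupp, Finset.mem_filter]
      refine ⟨g, ⟨hg, fun h0 => ?_⟩, hig⟩
      have := congrFun h0 i
      simp [restr, hig] at this
      simp [supp, this] at hi
    · intro a ha b hb hab
      simp only [gsupp, Finset.coe_filter, Set.mem_ofPred_eq] at ha hb
      exact hG.2.1 a ha.1 b hb.1 hab
  have h2 : ∑ g ∈ gsupp G β, l2 (restr b g) ≤ Real.sqrt ((gsupp G β).card) *
      Real.sqrt (∑ g ∈ gsupp G β, l2 (restr b g) ^ 2) := by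
    have := sum_abs_le (gsupp G β) (fun g => l2 (restr b g))
    simpa only [abs_of_nonneg (l2_nonneg _)] using this
  have h3 := mul_le_mul_of_nonneg_left h1 hα0
  have h4 := mul_le_mul_of_nonneg_left h2 (sub_nonneg.2 hα1)
  unfold sgl0
  linarith

/-- first-order condition -/
lemma kkt {p T : ℕ} (α : ℝ) (hα0 : 0 ≤ α) (hα1 : α ≤ 1) (G : Finset (Finset (Fin p)))
    (X : Matrix (Fin T) (Fin p) ℝ) (y : Fin T → ℝ) (lam : ℝ) (hlam : 0 < lam)
    (β βhat : Fin p → ℝ)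
    (hmin : ∀ b : Fin p → ℝ,
      normT2 (y - X.mulVec βhat) + 2 * lam * sgl α G βhat ≤
        normT2 (y - X.mulVec b) + 2 * lam * sgl α G b) :
    (∑ t, (X.mulVec (βhat - β) t) ^ 2) / T - (∑ t, (y - X.mulVec β) t * X.mulVec (βhat - β) t) / T
      ≤ lam * (sgl α G β - sgl α G βhat) := by
  set D := X.mulVec (βhat - β) with hD
  set I := (∑ t, (D t) ^ 2) / T - (∑ t, (y - X.mulVec β) t * D t) / T with hI
  set M := (∑ t, (D t) ^ 2) / (T : ℝ) with hM
  have hM0 : 0 ≤ M := by positivity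
  have key : ∀ s : ℝ, 0 < s → s ≤ 1 → 2 * I ≤ s * M + 2 * lam * (sgl α G β - sgl α G βhat) := by
    intro s hs hs1
    have h1 := hmin ((1 - s) • βhat + s • β)
    have h2 := sgl_convex α hα0 hα1 G βhat β (1 - s) s (by linarith) hs.le
    have h3 : normT2 (y - X.mulVec ((1 - s) • βhat + s • β)) =
        normT2 (y - X.mulVec βhat) - 2 * s * I + s ^ 2 * M := by
      have e : ∀ t, (y - X.mulVec ((1 - s) • βhat + s • β)) t ^ 2 =
          (y - X.mulVec βhat) t ^ 2 - 2 * s * (D t ^ 2 - (y - X.mulVec β) t * D t)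
            + s ^ 2 * D t ^ 2 := by
        intro t
        simp only [hD, Matrix.mulVec_add, Matrix.mulVec_sub, Matrix.mulVec_smul, Pi.sub_apply,
          Pi.add_apply, Pi.smul_apply, smul_eq_mul]
        ring
      simp only [normT2, hI, hM, e, Finset.sum_add_distrib, Finset.sum_sub_distrib,
        ← Finset.mul_sum]
      ring
    rw [h3] at h1
    have h4 := mul_le_mul_of_nonneg_left h2 hlam.le
    have h5 : s * (2 * I) ≤ s * (s * M + 2 * lam * (sgl α G β - sgl α G βhat)) := by
      nlinarith
    exact le_of_mul_le_mul_left h5 hs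
  by_contra hcon
  push Not at hcon
  set d := I - lam * (sgl α G β - sgl α G βhat) with hd
  have hdp : 0 < d := by linarith
  have hpos : 0 < M + d := by linarith
  have h := key (d / (M + d)) (by positivity) (by rw [div_le_one hpos]; linarith)
  have : d / (M + d) * M ≤ d := by
    rw [div_mul_eq_mul_div, div_le_iff₀ hpos]; nlinarith
  linarith

lemma quad_bound {p T : ℕ} (X : Matrix (Fin T) (Fin p) ℝ) (Sig : Matrix (Fin p) (Fin p) ℝ)
    (ε : ℝ) (hconc : ∀ j k, |(∑ t, X t j * X t k) / T - Sig j k| ≤ ε) (Δ : Fin p → ℝ) :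
    ∑ j, ∑ k, Δ j * Sig j k * Δ k ≤ (∑ t, (X.mulVec Δ t) ^ 2) / T + ε * l1 Δ ^ 2 := by
  have h1 : (∑ t, (X.mulVec Δ t) ^ 2) / T =
      ∑ j, ∑ k, Δ j * ((∑ t, X t j * X t k) / T) * Δ k := by
    have : ∀ t, (X.mulVec Δ t) ^ 2 = ∑ j, ∑ k, Δ j * (X t j * X t k) * Δ k := by
      intro t
      rw [sq, Matrix.mulVec, dotProduct, Finset.sum_mul_sum]
      exact Finset.sum_congr rfl fun j _ => Finset.sum_congr rfl fun k _ => by ring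
    simp only [this]
    rw [Finset.sum_comm, Finset.sum_div]
    refine Finset.sum_congr rfl fun j _ => ?_
    rw [Finset.sum_comm, Finset.sum_div]
    refine Finset.sum_congr rfl fun k _ => ?_
    rw [← Finset.sum_mul, ← Finset.mul_sum]
    ring
  have h2 : ε * l1 Δ ^ 2 = ∑ j, ∑ k, ε * (|Δ j| * |Δ k|) := by
    simp only [← Finset.mul_sum]
    rw [sq, l1, Finset.sum_mul_sum]
    simp only [← Finset.mul_sum]
  rw [h1, h2, ← Finset.sum_add_distrib]
  refine Finset.sum_le_sum fun j _ => ?_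
  rw [← Finset.sum_add_distrib]
  refine Finset.sum_le_sum fun k _ => ?_
  have h3 : -(((∑ t, X t j * X t k) / T - Sig j k) * (Δ j * Δ k)) ≤ ε * (|Δ j| * |Δ k|) := by
    refine (neg_le_abs _).trans ?_
    rw [abs_mul, abs_mul]
    exact mul_le_mul_of_nonneg_right (hconc j k) (by positivity)
  linarith

set_option maxHeartbeats 1000000

/-- deterministic prediction oracle inequality for the sg-LASSO
(deterministic core of Theorem 1):
`‖X(β̂ − β)‖_T² ≤ C₁ s_α λ² + 4‖m − Xβ‖_T²`,
with `C₁ = 4A(1+c₀)²(1+1/c)²/γ` and `A = 2(1+2c₀)²/(2(1+2c₀)² − (1+c₀)²)`. -/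
theorem sgLasso_prediction_oracle
    (p T : ℕ) (hp : 1 ≤ p) (hT : 1 ≤ T)
    (α : ℝ) (hα0 : 0 ≤ α) (hα1 : α ≤ 1)
    (G : Finset (Finset (Fin p))) (hG : IsPartition G)
    (X : Matrix (Fin T) (Fin p) ℝ) (m u : Fin T → ℝ)
    (lam c c0 : ℝ) (hlam : 0 < lam) (hc : 1 < c) (hc0 : c0 = (c + 1) / (c - 1))
    (β : Fin p → ℝ) (hβ : β ≠ 0) (βhat : Fin p → ℝ)
    (hmin : ∀ b : Fin p → ℝ,
      normT2 (m + u - X.mulVec βhat) + 2 * lam * sgl α G βhat ≤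
        normT2 (m + u - X.mulVec b) + 2 * lam * sgl α G b)
    (hdual : ∀ b : Fin p → ℝ,
      |∑ t, u t * X.mulVec b t| / T ≤ (lam / c) * sgl α G b)
    (Sig : Matrix (Fin p) (Fin p) ℝ) (hsym : ∀ j k, Sig j k = Sig k j)
    (γ : ℝ) (hγ : 0 < γ)
    (hRE : ∀ Δ : Fin p → ℝ, sgl1 α G β Δ ≤ c0 * sgl0 α G β Δ →
      γ * ∑ g ∈ gsupp G β, (l2 (restr Δ g)) ^ 2 ≤ ∑ j, ∑ k, Δ j * Sig j k * Δ k)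
    (hconc : ∀ j k, |(∑ t, X t j * X t k) / T - Sig j k| ≤
      γ / (2 * ((G.sup Finset.card : ℕ) : ℝ) * salpha α G β * (1 + 2 * c0) ^ 2))
    (A C1 : ℝ)
    (hA : A = 2 * (1 + 2 * c0) ^ 2 / (2 * (1 + 2 * c0) ^ 2 - (1 + c0) ^ 2))
    (hC1 : C1 = 4 * A * (1 + c0) ^ 2 * (1 + 1 / c) ^ 2 / γ) :
    normT (X.mulVec (βhat - β)) ^ 2 ≤
      C1 * salpha α G β * lam ^ 2 + 4 * normT (m - X.mulVec β) ^ 2 := by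
  classical
  obtain ⟨Δ, rfl⟩ : ∃ Δ, βhat = β + Δ := ⟨βhat - β, by simp⟩
  have hk := kkt α hα0 hα1 G X (m + u) lam hlam β (β + Δ) hmin
  rw [add_sub_cancel_left] at hk ⊢
  have hTpos : (0 : ℝ) < T := by exact_mod_cast hT
  have hnT : ∀ v : Fin T → ℝ, normT v ^ 2 = (∑ t, v t ^ 2) / T := fun v =>
    Real.sq_sqrt (by positivity)
  set x := normT (X.mulVec Δ) with hx
  set r := normT (m - X.mulVec β) with hr
  have hx0 : 0 ≤ x := Real.sqrt_nonneg _
  have hr0 : 0 ≤ r := Real.sqrt_nonneg _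
  have hx2 := hnT (X.mulVec Δ)
  have hr2 := hnT (m - X.mulVec β)
  rw [← hx] at hx2
  rw [← hr] at hr2
  rw [← hx2] at hk
  have hcs : (∑ t, (m - X.mulVec β) t * X.mulVec Δ t) / T ≤ r * x := by
    refine (abs_le_of_sq_le_sq' ?_ (mul_nonneg hr0 hx0)).2
    rw [mul_pow, hr2, hx2, div_pow, div_mul_div_comm, ← sq]
    exact div_le_div_of_nonneg_right (Finset.sum_mul_sq_le_sq_mul_sq _ _ _) (by positivity)
  have hu : (∑ t, u t * X.mulVec Δ t) / T ≤ lam / c * sgl α G Δ :=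
    (div_le_div_of_nonneg_right (le_abs_self _) hTpos.le).trans (hdual Δ)
  have hsum : (∑ t, (m + u - X.mulVec β) t * X.mulVec Δ t) / T =
      (∑ t, (m - X.mulVec β) t * X.mulVec Δ t) / T + (∑ t, u t * X.mulVec Δ t) / T := by
    rw [← add_div, ← Finset.sum_add_distrib]
    congr 1
    refine Finset.sum_congr rfl fun t _ => ?_
    simp only [Pi.add_apply, Pi.sub_apply]; ring
  have hdec := mul_le_mul_of_nonneg_left (sgl_decomp α hα0 hα1 G β Δ) hlam.le
  have hsplit := sgl_split α G β Δ
  have hω := sgl0_le α hα0 hα1 hG β Δ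
  have hc1 : 0 < c - 1 := by linarith
  have hcp : 0 < c := by linarith
  have hc0p : 1 < c0 := by rw [hc0, lt_div_iff₀ hc1]; linarith
  set w0 := sgl0 α G β Δ with hw0
  set w1 := sgl1 α G β Δ with hw1
  set q := Real.sqrt (∑ g ∈ gsupp G β, l2 (restr Δ g) ^ 2) with hq
  set σ := α * Real.sqrt ((supp β).card) + (1 - α) * Real.sqrt ((gsupp G β).card) with hσ
  have hsal : salpha α G β = σ ^ 2 := rfl
  have hσ0 : 0 ≤ σ := by
    have := sub_nonneg.2 hα1
    positivity
  have hq0 : 0 ≤ q := Real.sqrt_nonneg _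
  have hq2 : q ^ 2 = ∑ g ∈ gsupp G β, l2 (restr Δ g) ^ 2 :=
    Real.sq_sqrt (Finset.sum_nonneg fun _ _ => sq_nonneg _)
  have hmain : x ^ 2 ≤ r * x + lam * (1 + 1 / c) * w0 - lam * (1 - 1 / c) * w1 := by
    rw [hsplit] at hu
    have : lam / c * (w0 + w1) = lam * (1 / c) * w0 + lam * (1 / c) * w1 := by ring
    linarith
  have hden : 0 < 2 * (1 + 2 * c0) ^ 2 - (1 + c0) ^ 2 := by
    have : (1 + c0) ^ 2 ≤ (1 + 2 * c0) ^ 2 := pow_le_pow_left₀ (by linarith) (by linarith) 2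
    have : 0 < (1 + c0) ^ 2 := pow_pos (by linarith) 2
    linarith
  have hA0 : 0 < A := by rw [hA]; positivity
  have hC10 : 0 ≤ C1 := by rw [hC1]; positivity
  rw [hsal] at hconc ⊢
  rcases le_or_gt x (2 * r) with hcase | hcase
  · have : x ^ 2 ≤ (2 * r) ^ 2 := pow_le_pow_left₀ hx0 hcase 2
    have : 0 ≤ C1 * σ ^ 2 * lam ^ 2 := by positivity
    linarith
  have hhalf : x ^ 2 / 2 ≤ lam * (1 + 1 / c) * w0 - lam * (1 - 1 / c) * w1 := by
    have : r * x ≤ x / 2 * x := mul_le_mul_of_nonneg_right (by linarith) hx0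
    linarith
  have hcone : w1 ≤ c0 * w0 := by
    have h1 : lam * (1 - 1 / c) * w1 ≤ lam * (1 + 1 / c) * w0 := by
      have := sq_nonneg x
      linarith
    have h2 : lam * (1 - 1 / c) * w1 = lam / c * ((c - 1) * w1) := by field_simp
    have h3 : lam * (1 + 1 / c) * w0 = lam / c * ((c + 1) * w0) := by field_simp
    rw [h2, h3] at h1
    have h4 := le_of_mul_le_mul_left h1 (by positivity)
    rw [hc0, div_mul_eq_mul_div, le_div_iff₀ hc1]
    linarith
  have hw1n : 0 ≤ w1 := by
    have a := sub_nonneg.2 hα1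
    have b : 0 ≤ l1 (restr Δ (supp β)ᶜ) := Finset.sum_nonneg fun i _ => abs_nonneg _
    have d : 0 ≤ ∑ g ∈ G \ gsupp G β, l2 (restr Δ g) := Finset.sum_nonneg fun i _ => l2_nonneg _
    rw [hw1]; unfold sgl1; positivity
  have hw0n : 0 ≤ w0 := nonneg_of_mul_nonneg_right (hw1n.trans hcone) (by linarith)
  have hx1 : x ^ 2 ≤ 2 * lam * (1 + 1 / c) * (σ * q) := by
    have h1 : 0 ≤ lam * (1 - 1 / c) * w1 := by
      have : 1 / c ≤ 1 := by rw [div_le_one hcp]; exact hc.le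
      have := sub_nonneg.2 this
      positivity
    have h2 : lam * (1 + 1 / c) * w0 ≤ lam * (1 + 1 / c) * (σ * q) :=
      mul_le_mul_of_nonneg_left hω (by positivity)
    linarith
  have hre := hRE Δ hcone
  rw [← hq2] at hre
  have hqb := quad_bound X Sig _ hconc Δ
  rw [← hx2] at hqb
  obtain ⟨n, hn⟩ : ∃ n, n = G.sup Finset.card := ⟨_, rfl⟩
  have hn1 : 1 ≤ n := by
    obtain ⟨g, hg, hig⟩ := hG.2.2 ⟨0, hp⟩
    rw [hn]
    exact (Finset.card_pos.2 ⟨_, hig⟩).trans_le (Finset.le_sup (f := Finset.card) hg)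
  have hl := l1_le α hα0 hα1 hG Δ n hn hn1
  rw [← hn] at hqb
  have hn0 : (0 : ℝ) < n := by exact_mod_cast hn1
  have hl0 : 0 ≤ l1 Δ := Finset.sum_nonneg fun i _ => abs_nonneg _
  have hl2 : l1 Δ ^ 2 ≤ n * ((1 + c0) ^ 2 * (σ ^ 2 * q ^ 2)) := by
    have h1 : sgl α G Δ ≤ (1 + c0) * (σ * q) := by
      have h0 : (1 + c0) * w0 ≤ (1 + c0) * (σ * q) :=
        mul_le_mul_of_nonneg_left hω (by linarith)
      rw [hsplit]; linarith
    have h2 : l1 Δ ≤ Real.sqrt n * ((1 + c0) * (σ * q)) :=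
      hl.trans (mul_le_mul_of_nonneg_left h1 (Real.sqrt_nonneg _))
    have h3 := pow_le_pow_left₀ hl0 h2 2
    rw [mul_pow, Real.sq_sqrt hn0.le] at h3
    linarith
  have herr : γ / (2 * (n : ℝ) * σ ^ 2 * (1 + 2 * c0) ^ 2) * l1 Δ ^ 2 ≤
      γ * q ^ 2 * ((1 + c0) ^ 2 / (2 * (1 + 2 * c0) ^ 2)) := by
    refine (mul_le_mul_of_nonneg_left hl2 (by positivity)).trans ?_
    rcases hσ0.eq_or_lt with h | h
    · rw [← h]; simp; positivity
    · apply le_of_eq; field_simp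
  have hk2 : γ * q ^ 2 ≤ A * x ^ 2 := by
    have h1 : γ * q ^ 2 * (1 - (1 + c0) ^ 2 / (2 * (1 + 2 * c0) ^ 2)) ≤ x ^ 2 := by linarith
    have h2 : A * (1 - (1 + c0) ^ 2 / (2 * (1 + 2 * c0) ^ 2)) = 1 := by
      rw [hA]
      have := hden.ne'
      have : (1 + 2 * c0) ≠ 0 := by positivity
      field_simp
    have h3 := mul_le_mul_of_nonneg_left h1 hA0.le
    calc γ * q ^ 2 = γ * q ^ 2 * (A * (1 - (1 + c0) ^ 2 / (2 * (1 + 2 * c0) ^ 2))) := by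
          rw [h2, mul_one]
      _ ≤ _ := by linarith
  have hfin : x ^ 2 ≤ 4 * A * (1 + 1 / c) ^ 2 / γ * σ ^ 2 * lam ^ 2 := by
    have h1 : (x ^ 2) ^ 2 ≤ (2 * lam * (1 + 1 / c) * (σ * q)) ^ 2 :=
      pow_le_pow_left₀ (sq_nonneg x) hx1 2
    have h2 : (2 * lam * (1 + 1 / c) * (σ * q)) ^ 2 =
        4 * lam ^ 2 * (1 + 1 / c) ^ 2 * σ ^ 2 / γ * (γ * q ^ 2) := by
      field_simp; ring
    have h3 : 4 * lam ^ 2 * (1 + 1 / c) ^ 2 * σ ^ 2 / γ * (γ * q ^ 2) ≤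
        4 * lam ^ 2 * (1 + 1 / c) ^ 2 * σ ^ 2 / γ * (A * x ^ 2) :=
      mul_le_mul_of_nonneg_left hk2 (by positivity)
    have hxp : 0 < x ^ 2 := by
      have : 0 < x := by linarith
      positivity
    refine le_of_mul_le_mul_left ?_ hxp
    calc x ^ 2 * x ^ 2 = (x ^ 2) ^ 2 := by ring
      _ ≤ 4 * lam ^ 2 * (1 + 1 / c) ^ 2 * σ ^ 2 / γ * (A * x ^ 2) := by linarith
      _ = _ := by ring
  have hlast : 4 * A * (1 + 1 / c) ^ 2 / γ * σ ^ 2 * lam ^ 2 ≤ C1 * σ ^ 2 * lam ^ 2 := by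
    have h1 : (1 : ℝ) ≤ (1 + c0) ^ 2 := one_le_pow₀ (by linarith)
    have h2 : C1 * σ ^ 2 * lam ^ 2 =
        (4 * A * (1 + 1 / c) ^ 2 / γ * σ ^ 2 * lam ^ 2) * (1 + c0) ^ 2 := by
      rw [hC1]; ring
    rw [h2]
    exact le_mul_of_one_le_right (by positivity) h1
  have := sq_nonneg r
  linarith
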